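/- The square relations derived from the bone relations hold: X² = −(Y·Z), Y² = −(Z·X), and Z² = −(X·Y). -/

import Mathlib

open Matrix

/-- `ω = exp(2πi/12)`, a primitive 12th root of unity. -/
noncomputable def ω : ℂ := Complex.exp (2 * Real.pi * Complex.I / 12)

/-- The SL₂(ℂ) connection matrix on northeast edges. -/
noncomputable def α : Matrix (Fin 2) (Fin 2) ℂ := !![ω^7, 0; 0, ω^5]

/-- The SL₂(ℂ) connection matrix on northwest edges. -/
noncomputable def β : Matrix (Fin 2) (Fin 2) ℂ := !![ω^7, ω^3; 0, ω^5]

/-- The SL₂(ℂ) connection matrix on horizontal edges. -/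
noncomputable def γ : Matrix (Fin 2) (Fin 2) ℂ := !![ω^5, 0; ω^3, ω^7]

/-- The length-two move `X = β·α`. -/
noncomputable def X : Matrix (Fin 2) (Fin 2) ℂ := β * α

/-- The length-two move `Y = α⁻¹·γ`. -/
noncomputable def Y : Matrix (Fin 2) (Fin 2) ℂ := α⁻¹ * γ

/-- The length-two move `Z = γ⁻¹·β⁻¹`. -/
noncomputable def Z : Matrix (Fin 2) (Fin 2) ℂ := γ⁻¹ * β⁻¹

/-- `x = X⁻¹`. -/
noncomputable def x : Matrix (Fin 2) (Fin 2) ℂ := X⁻¹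

/-- `y = Y⁻¹`. -/
noncomputable def y : Matrix (Fin 2) (Fin 2) ℂ := Y⁻¹

/-- `z = Z⁻¹`. -/
noncomputable def z : Matrix (Fin 2) (Fin 2) ℂ := Z⁻¹

theorem ω_pow_four : ω ^ 4 = ω ^ 2 - 1 := by
  have h : ω ^ 2 = 1 / 2 + (√3 / 2 : ℝ) * Complex.I := by
    rw [ω, ← Complex.exp_nat_mul,
      show ((2 : ℕ) : ℂ) * (2 * Real.pi * Complex.I / 12) = (Real.pi / 3 : ℝ) * Complex.I by
        push_cast; ring,
      Complex.exp_mul_I, ← Complex.ofReal_cos, ← Complex.ofReal_sin, Real.cos_pi_div_three,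
      Real.sin_pi_div_three]
    push_cast
    ring
  have h3 : ((√3 : ℝ) : ℂ) ^ 2 = 3 := by
    rw [← Complex.ofReal_pow, Real.sq_sqrt (by norm_num)]
    norm_num
  rw [show ω ^ 4 = (ω ^ 2) ^ 2 by ring, h]
  push_cast
  linear_combination (Complex.I ^ 2 / 4) * h3 + (3 / 4) * Complex.I_sq

theorem ω_pow_six : ω ^ 6 = -1 := by
  linear_combination (ω ^ 2 + 1) * ω_pow_four

theorem ω_pow_twelve : ω ^ 12 = 1 := by
  linear_combination (ω ^ 6 - 1) * ω_pow_six

theorem det_α : α.det = 1 := by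
  rw [α, det_fin_two_of]
  linear_combination ω_pow_twelve

theorem det_β : β.det = 1 := by
  rw [β, det_fin_two_of]
  linear_combination ω_pow_twelve

theorem det_γ : γ.det = 1 := by
  rw [γ, det_fin_two_of]
  linear_combination ω_pow_twelve

/-- By Cayley–Hamilton, a 2×2 matrix of determinant and trace 1 satisfies `M² = -M⁻¹`. -/
theorem sq_eq_neg_inv_of_det_eq_one_of_trace_eq_one {R : Type*} [CommRing R]
    {M : Matrix (Fin 2) (Fin 2) R} (hd : M.det = 1) (ht : M.trace = 1) : M ^ 2 = -M⁻¹ := by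
  rw [inv_def, hd, Ring.inverse_one, one_smul, adjugate_fin_two]
  rw [det_fin_two] at hd
  rw [trace_fin_two] at ht
  ext i j
  fin_cases i <;> fin_cases j <;> simp [sq, mul_apply, Fin.sum_univ_two]
  · linear_combination (M 0 0 + 1) * ht - hd
  · linear_combination M 0 1 * ht
  · linear_combination M 1 0 * ht
  · linear_combination (M 1 1 + 1) * ht - hd

theorem trace_X : X.trace = 1 := by
  simp [X, α, β, trace_fin_two]
  linear_combination (ω ^ 8 - ω ^ 2 + ω ^ 4) * ω_pow_six - ω_pow_four

theorem trace_Y : Y.trace = 1 := by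
  rw [Y, inv_def, det_α, Ring.inverse_one, one_smul]
  simp [α, γ, adjugate_fin_two, trace_fin_two]
  linear_combination (ω ^ 8 - ω ^ 2 + ω ^ 4) * ω_pow_six - ω_pow_four

theorem trace_Z : Z.trace = 1 := by
  rw [Z, inv_def, inv_def, det_β, det_γ, Ring.inverse_one, one_smul, one_smul]
  simp [β, γ, adjugate_fin_two, trace_fin_two]
  linear_combination 2 * ω_pow_twelve + ω_pow_six

/-- Square relations derived from the bone relations: `X² = -(Y·Z)`, `Y² = -(Z·X)`,
`Z² = -(X·Y)`. -/
theorem square_relations :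
    X^2 = -(Y * Z) ∧ Y^2 = -(Z * X) ∧ Z^2 = -(X * Y) := by
  have hα : IsUnit α.det := by simp [det_α]
  have hβ : IsUnit β.det := by simp [det_β]
  have hγ : IsUnit γ.det := by simp [det_γ]
  have hX : X⁻¹ = Y * Z := by
    rw [X, Y, Z, Matrix.mul_inv_rev, Matrix.mul_assoc, mul_nonsing_inv_cancel_left _ _ hγ]
  have hY : Y⁻¹ = Z * X := by
    rw [X, Y, Z, Matrix.mul_inv_rev, Matrix.mul_assoc, nonsing_inv_mul_cancel_left _ _ hβ,
      nonsing_inv_nonsing_inv _ hα]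
  have hZ : Z⁻¹ = X * Y := by
    rw [X, Y, Z, Matrix.mul_inv_rev, Matrix.mul_assoc, mul_nonsing_inv_cancel_left _ _ hα,
      nonsing_inv_nonsing_inv _ hβ, nonsing_inv_nonsing_inv _ hγ]
  have dX : X.det = 1 := by simp [X, det_α, det_β]
  have dY : Y.det = 1 := by simp [Y, det_nonsing_inv, det_α, det_γ]
  have dZ : Z.det = 1 := by simp [Z, det_nonsing_inv, det_β, det_γ]
  rw [← hX, ← hY, ← hZ]
  exact ⟨sq_eq_neg_inv_of_det_eq_one_of_trace_eq_one dX trace_X,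
    sq_eq_neg_inv_of_det_eq_one_of_trace_eq_one dY trace_Y,
    sq_eq_neg_inv_of_det_eq_one_of_trace_eq_one dZ trace_Z⟩
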